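/- Let m, k, i be positive integers with m ≥ 2k+2 and i ≠ k (so 1 ≤ i ≤ k−1 and k ≥ 2). Then the relative fixity of the distance-i Johnson graph J(m,k,i) equals 1 − 2k(m−k)/(m(m−1)); equivalently, Fix(J(m,k,i)) = C(m,k) − 2·C(m−2,k−1). -/

import Mathlib

/-- A permutation `g` of the vertex set is an automorphism of the (di)graph with arc
relation `A` if `(u,v)` is an arc iff `(g u, g v)` is an arc. -/
def IsDigraphAut {V : Type*} (A : V → V → Prop) (g : Equiv.Perm V) : Prop :=
  ∀ u v : V, A u v ↔ A (g u) (g v)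

/-- The fixity of a digraph: the largest number of vertices fixed by a nontrivial
automorphism (0 if there is none). -/
noncomputable def digraphFixity {V : Type*} (A : V → V → Prop) : ℕ :=
  sSup ((fun g : Equiv.Perm V => Nat.card {v : V // g v = v}) ''
    {g : Equiv.Perm V | IsDigraphAut A g ∧ g ≠ 1})

/-- The adjacency relation of the distance-i Johnson graph J(m,k,i): the vertices are the
k-element subsets of an m-element set, and X is adjacent to Y iff |X ∩ Y| = k − i. -/
def johnsonAdj (m k i : ℕ) (X Y : {S : Finset (Fin m) // S.card = k}) : Prop :=
  (X.val ∩ Y.val).card = k - i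

/-- The binomial coefficient with an integer lower index, zero when that index is negative. -/
def intChoose (n : ℕ) (z : ℤ) : ℤ := if 0 ≤ z then (n.choose z.toNat : ℤ) else 0

theorem intChoose_natCast (n s : ℕ) : intChoose n (s : ℤ) = n.choose s := by
  simp [intChoose]

theorem intChoose_of_neg (n : ℕ) {z : ℤ} (hz : z < 0) : intChoose n z = 0 := by
  simp [intChoose, hz]

theorem intChoose_of_gt (n : ℕ) {z : ℤ} (hz : (n : ℤ) < z) : intChoose n z = 0 := by
  lift z to ℕ using by omega
  rw [intChoose_natCast, Nat.choose_eq_zero_of_lt (by exact_mod_cast hz), Nat.cast_zero]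

theorem intChoose_nonneg (n : ℕ) (z : ℤ) : 0 ≤ intChoose n z := by
  unfold intChoose; split_ifs <;> positivity

theorem intChoose_pos {n : ℕ} {z : ℤ} (h0 : 0 ≤ z) (h1 : z ≤ n) : 0 < intChoose n z := by
  lift z to ℕ using h0
  rw [intChoose_natCast]
  exact_mod_cast Nat.choose_pos (by exact_mod_cast h1)

theorem intChoose_zero (z : ℤ) : intChoose 0 z = if z = 0 then 1 else 0 := by
  rcases lt_trichotomy z 0 with h | h | h
  · rw [intChoose_of_neg _ h, if_neg h.ne]
  · subst h; simp [intChoose]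
  · rw [intChoose_of_gt _ (by simpa using h), if_neg h.ne']

theorem intChoose_succ (n : ℕ) (z : ℤ) :
    intChoose (n + 1) z = intChoose n z + intChoose n (z - 1) := by
  rcases lt_trichotomy z 0 with h | h | h
  · simp [intChoose_of_neg _ h, intChoose_of_neg n (show z - 1 < 0 by omega)]
  · subst h; simp [intChoose]
  · obtain ⟨s, rfl⟩ : ∃ s : ℕ, z = (s + 1 : ℕ) := ⟨z.toNat - 1, by omega⟩
    rw [show ((s + 1 : ℕ) : ℤ) - 1 = s by push_cast; ring]
    simp only [intChoose_natCast, Nat.choose_succ_succ]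
    push_cast; ring

/-- The absorption identity. -/
theorem intChoose_absorb (n : ℕ) (z : ℤ) :
    intChoose n (z + 1) * (z + 1) = intChoose n z * (n - z) := by
  rcases lt_or_ge z 0 with h | h
  · rw [intChoose_of_neg n h]
    rcases eq_or_ne z (-1) with rfl | h'
    · simp
    · rw [intChoose_of_neg n (by omega : z + 1 < 0)]; simp
  · lift z to ℕ using h
    rcases le_or_gt z n with h' | h'
    · rw [← Nat.cast_succ, intChoose_natCast, intChoose_natCast, ← Nat.cast_sub h']
      exact_mod_cast Nat.choose_succ_right_eq n z
    · rw [intChoose_of_gt n (by omega), intChoose_of_gt n (by omega)]; simp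

theorem intChoose_neighbours_identity (n : ℕ) (s : ℤ) :
    (intChoose n (s - 1) + intChoose n (s + 1) - intChoose n s) * ((s + 1) * (n - s + 1))
      = intChoose n s * (s ^ 2 + (n - s) ^ 2 - s * (n - s) - 1) := by
  have h1 := intChoose_absorb n s
  have h2 := intChoose_absorb n (s - 1)
  rw [sub_add_cancel] at h2
  linear_combination (n - s + 1) * h1 - (s + 1) * h2

theorem intChoose_le_neighbours {n : ℕ} (hn : 1 ≤ n) (s : ℤ) :
    intChoose n s ≤ intChoose n (s - 1) + intChoose n (s + 1) := by
  by_cases hs : 0 ≤ s ∧ s ≤ n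
  · have h := intChoose_neighbours_identity n s
    have hp : (0 : ℤ) < (s + 1) * (n - s + 1) := by
      apply mul_pos <;> omega
    have h3 : 0 ≤ intChoose n s * (s ^ 2 + (n - s) ^ 2 - s * (n - s) - 1) := by
      apply mul_nonneg (intChoose_nonneg n s)
      obtain ⟨y, hy⟩ : ∃ y : ℤ, y = n - s := ⟨_, rfl⟩
      rw [← hy]
      have : 0 ≤ y := by omega
      have : 1 ≤ s + y := by omega
      nlinarith [sq_nonneg (s - y), mul_nonneg hs.1 ‹0 ≤ y›]
    rw [← h] at h3
    have := nonneg_of_mul_nonneg_left h3 hp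
    linarith
  · have : intChoose n s = 0 := by
      by_cases h : 0 ≤ s
      · exact intChoose_of_gt n (by omega)
      · exact intChoose_of_neg n (by omega)
    rw [this]
    exact add_nonneg (intChoose_nonneg _ _) (intChoose_nonneg _ _)

theorem intChoose_lt_neighbours {n : ℕ} (hn : 3 ≤ n) {s : ℤ} (h0 : 0 ≤ s) (h1 : s ≤ n) :
    intChoose n s < intChoose n (s - 1) + intChoose n (s + 1) := by
  have h := intChoose_neighbours_identity n s
  have hp : (0 : ℤ) < (s + 1) * (n - s + 1) := by
    apply mul_pos <;> omega
  have h3 : 0 < intChoose n s * (s ^ 2 + (n - s) ^ 2 - s * (n - s) - 1) := by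
    apply mul_pos (intChoose_pos h0 h1)
    obtain ⟨y, hy⟩ : ∃ y : ℤ, y = n - s := ⟨_, rfl⟩
    rw [← hy]
    have : 0 ≤ y := by omega
    have : 3 ≤ s + y := by omega
    nlinarith [sq_nonneg (s - y), mul_nonneg h0 ‹0 ≤ y›]
  rw [← h] at h3
  have := pos_of_mul_pos_left h3 hp.le
  linarith

/-- Given `k`-sets `X`, `Y` with `|X \ Y| = j`, `|X ∩ Y| = p`, and `q` points outside `X ∪ Y`,
this counts the sets meeting both `X` and `Y` in `t` points and having `i` points outside `X`. -/
def commonCount (j p q : ℕ) (t i : ℤ) : ℤ :=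
  ∑ h ∈ Finset.range (j + 1),
    intChoose j h ^ 2 * intChoose p (t - h) * intChoose q (i - h)

theorem commonCount_succ_left (j p q : ℕ) (t i : ℤ) :
    commonCount j (p + 1) q t i = commonCount j p q t i + commonCount j p q (t - 1) i := by
  simp only [commonCount, ← Finset.sum_add_distrib, intChoose_succ p]
  refine Finset.sum_congr rfl fun h _ => ?_
  rw [show t - h - 1 = t - 1 - h by ring]; ring

theorem commonCount_succ_right (j p q : ℕ) (t i : ℤ) :
    commonCount j p (q + 1) t i = commonCount j p q t i + commonCount j p q t (i - 1) := by
  simp only [commonCount, ← Finset.sum_add_distrib, intChoose_succ q]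
  refine Finset.sum_congr rfl fun h _ => ?_
  rw [show i - h - 1 = i - 1 - h by ring]; ring

theorem commonCount_zero_left (j q : ℕ) (t i : ℤ) :
    commonCount j 0 q t i = intChoose j t ^ 2 * intChoose q (i - t) := by
  unfold commonCount
  by_cases ht : 0 ≤ t ∧ t ≤ j
  · obtain ⟨h0, h1⟩ := ht
    lift t to ℕ using h0
    rw [Finset.sum_eq_single t]
    · simp [intChoose_zero]
    · intro b _ hb
      rw [intChoose_zero, if_neg (by omega)]; simp
    · intro hb; simp at hb; omega
  · have : intChoose j t = 0 := by
      by_cases h : 0 ≤ t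
      · exact intChoose_of_gt j (by omega)
      · exact intChoose_of_neg j (by omega)
    rw [this]
    simp only [ne_eq, OfNat.ofNat_ne_zero, not_false_eq_true, zero_pow, zero_mul]
    refine Finset.sum_eq_zero fun h hh => ?_
    rw [Finset.mem_range] at hh
    rw [intChoose_zero, if_neg (by omega)]; simp

theorem commonCount_one (p q : ℕ) (t i : ℤ) :
    commonCount 1 p q t i
      = intChoose p t * intChoose q i + intChoose p (t - 1) * intChoose q (i - 1) := by
  simp [commonCount, Finset.sum_range_succ, intChoose]

theorem intChoose_three_of_ne {z : ℤ} (h0 : z ≠ 0) (h1 : z ≠ 1) (h2 : z ≠ 2) (h3 : z ≠ 3) :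
    intChoose 3 z = 0 := by
  by_cases h : 0 ≤ z
  · exact intChoose_of_gt 3 (by push_cast; omega)
  · exact intChoose_of_neg 3 (by omega)

theorem commonCount_one_three (j : ℕ) (t i : ℤ) :
    commonCount j 1 3 t i = intChoose j t ^ 2 * intChoose 3 (i - t)
      + intChoose j (t - 1) ^ 2 * intChoose 3 (i - t + 1) := by
  rw [commonCount_succ_left, commonCount_zero_left, commonCount_zero_left]
  ring_nf

theorem commonCount_base_le {j : ℕ} (hj : 1 ≤ j) (t i : ℤ) :
    commonCount j 1 3 t i ≤ commonCount 1 j (j + 2) t i ∧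
    (3 ≤ j → 1 ≤ t → t ≤ j → 0 ≤ i → i ≤ j + 3 →
      commonCount j 1 3 t i < commonCount 1 j (j + 2) t i) := by
  rw [commonCount_one_three, commonCount_one]
  obtain ⟨d, rfl⟩ : ∃ d, i = t + d := ⟨i - t, by ring⟩
  have N := intChoose_nonneg j
  have key1 := intChoose_le_neighbours hj t
  have key2 := intChoose_le_neighbours hj (t - 1)
  have str1 : 3 ≤ j → 1 ≤ t → t ≤ j →
      intChoose j t < intChoose j (t - 1) + intChoose j (t + 1) :=
    fun h a b => intChoose_lt_neighbours h (by omega) b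
  have str2 : 3 ≤ j → 1 ≤ t → t ≤ j →
      intChoose j (t - 1) < intChoose j (t - 1 - 1) + intChoose j (t - 1 + 1) :=
    fun h a b => intChoose_lt_neighbours h (by omega) (by omega)
  have pos1 : 1 ≤ t → t ≤ j → 0 < intChoose j t := fun a b => intChoose_pos (by omega) b
  have pos2 : 1 ≤ t → t ≤ j → 0 < intChoose j (t - 1) :=
    fun a b => intChoose_pos (by omega) (by omega)
  rw [sub_add_cancel] at key2 str2
  simp only [add_sub_cancel_left]
  by_cases hd : d = -1 ∨ d = 0 ∨ d = 1 ∨ d = 2 ∨ d = 3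
  · have s2 (z : ℤ) :
        intChoose (j + 2) z = intChoose j z + 2 * intChoose j (z - 1) + intChoose j (z - 2) := by
      rw [show j + 2 = (j + 1) + 1 from rfl, intChoose_succ (j + 1), intChoose_succ j,
        intChoose_succ j, show z - 1 - 1 = z - 2 by ring]
      ring
    rw [s2, s2]
    have e3 : intChoose 3 3 = 1 := by decide
    have e2 : intChoose 3 2 = 3 := by decide
    have e1 : intChoose 3 1 = 3 := by decide
    have e0 : intChoose 3 0 = 1 := by decide
    have em : intChoose 3 (-1) = 0 := by decide
    have e4 : intChoose 3 4 = 0 := by decide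
    have n1 := N (t - 1)
    have n2 := N t
    have n3 := N (t + 1)
    have n4 := N (t - 1 - 1)
    have w1 := mul_nonneg n2 (sub_nonneg.2 key1)
    have w2 := mul_nonneg n1 (sub_nonneg.2 key2)
    have v1 (h : 3 ≤ j) (a : 1 ≤ t) (b : t ≤ j) := mul_pos (pos1 a b) (sub_pos.2 (str1 h a b))
    have v2 (h : 3 ≤ j) (a : 1 ≤ t) (b : t ≤ j) := mul_pos (pos2 a b) (sub_pos.2 (str2 h a b))
    clear str1 str2 pos1 pos2 s2 key1 key2
    have r1 : t - 1 - 1 = t - 2 := by ring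
    have r2 : t - 1 - 2 = t - 3 := by ring
    have p12 := mul_nonneg n1 n2
    have p13 := mul_nonneg n1 n3
    have p24 := mul_nonneg n2 n4
    rcases hd with rfl | rfl | rfl | rfl | rfl
    · have q1 : t + -1 = t - 1 := by ring
      have q2 : (-1 : ℤ) + 1 = 0 := by ring
      have m1 := mul_nonneg n2 (N (t - 3))
      have m2 := mul_nonneg n1 (N (t - 3))
      have m3 := mul_nonneg n1 (N (t - 4))
      have q3 : t - 2 - 2 = t - 4 := by ring
      have q4 : t - 2 - 1 = t - 3 := by ring
      simp only [q1, q2, q3, q4, r1, r2, em, e0, e1, e2, e3, e4] at *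
      exact ⟨by linarith, fun h a b _ _ => by linarith [v1 h a b, v2 h a b]⟩
    · have m2 := mul_nonneg n1 (N (t - 3))
      simp only [add_zero, zero_add, r1, r2, em, e0, e1, e2, e3, e4] at *
      exact ⟨by linarith, fun h a b _ _ => by linarith [v1 h a b, v2 h a b]⟩
    · have q1 : t + 1 - 1 = t := by ring
      have q2 : (1 : ℤ) + 1 = 2 := by ring
      have q3 : t + 1 - 2 = t - 1 := by ring
      simp only [q1, q2, q3, r1, r2, em, e0, e1, e2, e3, e4] at *
      exact ⟨by linarith, fun h a b _ _ => by linarith [v1 h a b, v2 h a b]⟩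
    · have q1 : t + 2 - 1 = t + 1 := by ring
      have q2 : (2 : ℤ) + 1 = 3 := by ring
      have q3 : t + 2 - 2 = t := by ring
      have q4 : t + 1 - 1 = t := by ring
      have q5 : t + 1 - 2 = t - 1 := by ring
      have m1 := mul_nonneg n2 (N (t + 2))
      simp only [q1, q2, q3, q4, q5, r1, r2, em, e0, e1, e2, e3, e4] at *
      exact ⟨by linarith, fun h a b _ _ => by linarith [v1 h a b, v2 h a b]⟩
    · have q1 : t + 3 - 1 = t + 2 := by ring
      have q2 : (3 : ℤ) + 1 = 4 := by ring
      have q3 : t + 3 - 2 = t + 1 := by ring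
      have q4 : t + 2 - 1 = t + 1 := by ring
      have q5 : t + 2 - 2 = t := by ring
      have m1 := mul_nonneg n2 (N (t + 2))
      have m2 := mul_nonneg n2 (N (t + 3))
      have m3 := mul_nonneg n1 (N (t + 2))
      simp only [q1, q2, q3, q4, q5, r1, r2, em, e0, e1, e2, e3, e4] at *
      exact ⟨by linarith, fun h a b _ _ => by linarith [v1 h a b, v2 h a b]⟩
  · have z1 : intChoose 3 d = 0 := intChoose_three_of_ne (by omega) (by omega) (by omega) (by omega)
    have z2 : intChoose 3 (d + 1) = 0 :=
      intChoose_three_of_ne (by omega) (by omega) (by omega) (by omega)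
    rw [z1, z2]
    have M := intChoose_nonneg (j + 2)
    refine ⟨?_, fun h3 ht1 ht2 hi0 hi1 => ?_⟩
    · have := mul_nonneg (N t) (M (t + d))
      have := mul_nonneg (N (t - 1)) (M (t + d - 1))
      linarith
    · by_cases hle : t + d ≤ j + 2
      · have := mul_pos (pos1 ht1 ht2) (intChoose_pos (n := j + 2) hi0 (by push_cast; omega))
        have := mul_nonneg (N (t - 1)) (M (t + d - 1))
        linarith
      · have := mul_nonneg (N t) (M (t + d))
        have := mul_pos (pos2 ht1 ht2)
          (intChoose_pos (n := j + 2) (z := t + d - 1) (by omega) (by push_cast; omega))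
        linarith

theorem commonCount_base_lt {j : ℕ} (hj : 2 ≤ j) {t i : ℤ} (ht : 1 ≤ t) (htj : t ≤ j)
    (hi : 0 ≤ i) (hij : i ≤ j + 3) :
    commonCount j 1 3 t i < commonCount 1 j (j + 2) t i := by
  rcases hj.eq_or_lt with rfl | h
  · push_cast at htj hij
    interval_cases t <;> interval_cases i <;> decide
  · exact (commonCount_base_le (by omega) t i).2 h ht htj hi hij

theorem commonCount_le_one {j : ℕ} (hj : 1 ≤ j) (p q : ℕ) (t i : ℤ) :
    commonCount j (p + 1) (q + 3) t i ≤ commonCount 1 (p + j) (q + j + 2) t i := by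
  induction q generalizing t i with
  | zero =>
    induction p generalizing t i with
    | zero => simpa using (commonCount_base_le hj t i).1
    | succ p ih =>
      rw [commonCount_succ_left j (p + 1), show p + 1 + j = p + j + 1 by ring,
        commonCount_succ_left 1 (p + j)]
      exact add_le_add (ih _ _) (ih _ _)
  | succ q ih =>
    rw [show q + 1 + 3 = q + 3 + 1 by ring, commonCount_succ_right j (p + 1) (q + 3),
      show q + 1 + j + 2 = q + j + 2 + 1 by ring, commonCount_succ_right 1 (p + j)]
    exact add_le_add (ih _ _) (ih _ _)

theorem commonCount_lt_one {j : ℕ} (hj : 2 ≤ j) (p q : ℕ) {t i : ℤ} (ht : 1 ≤ t)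
    (htj : t ≤ p + j) (hi : 0 ≤ i) (hij : i ≤ q + j + 3) :
    commonCount j (p + 1) (q + 3) t i < commonCount 1 (p + j) (q + j + 2) t i := by
  induction q generalizing t i with
  | zero =>
    induction p generalizing t i with
    | zero => simpa using commonCount_base_lt hj ht (by simpa using htj) hi (by simpa using hij)
    | succ p ih =>
      rw [commonCount_succ_left j (p + 1), show p + 1 + j = p + j + 1 by ring,
        commonCount_succ_left 1 (p + j)]
      have h := commonCount_le_one (j := j) (by omega) p 0
      simp only [zero_add] at h ih ⊢
      by_cases htp : t ≤ p + j
      · exact add_lt_add_of_lt_of_le (ih ht htp hi hij) (h _ _)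
      · exact add_lt_add_of_le_of_lt (h _ _) (ih (by omega) (by push_cast at htj; omega) hi hij)
  | succ q ih =>
    rw [show q + 1 + 3 = q + 3 + 1 by ring, commonCount_succ_right j (p + 1) (q + 3),
      show q + 1 + j + 2 = q + j + 2 + 1 by ring, commonCount_succ_right 1 (p + j)]
    have h := commonCount_le_one (j := j) (by omega) p q
    by_cases hiq : i ≤ q + j + 3
    · exact add_lt_add_of_lt_of_le (ih ht htj hi hiq) (h _ _)
    · exact add_lt_add_of_le_of_lt (h _ _)
        (ih ht htj (by omega) (by push_cast at hij; omega))

theorem intChoose_add_ge (n q : ℕ) (s z : ℤ) :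
    intChoose n (s - 1) * intChoose q (z + 1) + intChoose n s * intChoose q z
      + intChoose n (s + 1) * intChoose q (z - 1) ≤ intChoose (n + q) (s + z) := by
  induction q generalizing z with
  | zero =>
    simp only [intChoose_zero, add_zero]
    rcases eq_or_ne z 0 with rfl | h0
    · simp
    rcases eq_or_ne z 1 with rfl | h1
    · simp
    rcases eq_or_ne z (-1) with rfl | h2
    · simp [← sub_eq_add_neg]
    rw [if_neg (by omega), if_neg (by omega), if_neg (by omega)]
    simpa using intChoose_nonneg _ _
  | succ q ih =>
    rw [← add_assoc, intChoose_succ q, intChoose_succ q, intChoose_succ q, intChoose_succ (n + q)]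
    have h1 := ih z
    have h2 := ih (z - 1)
    rw [show z - 1 + 1 = z + 1 - 1 by ring, show s + (z - 1) = s + z - 1 by ring] at h2
    linarith

theorem two_mul_intChoose_le (q : ℕ) {d : ℤ} (hd : 2 ≤ d) :
    2 * intChoose q d ≤ intChoose q (d + 1) + 2 * intChoose q (d - 1) := by
  rcases le_or_gt d q with h | h
  · have h1 := intChoose_absorb q d
    have h2 := intChoose_absorb q (d - 1)
    rw [sub_add_cancel] at h2
    have hid : (intChoose q (d + 1) + 2 * intChoose q (d - 1) - 2 * intChoose q d)
        * ((d + 1) * (q - d + 1))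
          = intChoose q d * ((q - d - d) * (q - d - d - 1) + (d - 2) * (d + 1)) := by
      linear_combination (q - d + 1) * h1 - 2 * (d + 1) * h2
    have hp : (0 : ℤ) < (d + 1) * (q - d + 1) := by apply mul_pos <;> omega
    have h3 : 0 ≤ intChoose q d * ((q - d - d) * (q - d - d - 1) + (d - 2) * (d + 1)) := by
      apply mul_nonneg (intChoose_nonneg _ _)
      apply add_nonneg
      · obtain ⟨e, he⟩ : ∃ e : ℤ, e = q - d - d := ⟨_, rfl⟩
        rw [← he]
        rcases le_or_gt e 0 with h | h
        · exact mul_nonneg_of_nonpos_of_nonpos h (by omega)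
        · exact mul_nonneg h.le (by omega)
      · apply mul_nonneg <;> omega
    rw [← hid] at h3
    have := nonneg_of_mul_nonneg_left h3 hp
    linarith
  · rw [intChoose_of_gt q h]
    have := intChoose_nonneg q (d + 1)
    have := intChoose_nonneg q (d - 1)
    linarith

theorem intChoose_zero_right (n : ℕ) : intChoose n 0 = 1 := by simp [intChoose]

theorem intChoose_one_right (n : ℕ) : intChoose n 1 = n := by simp [intChoose]

theorem two_mul_intChoose_two (n : ℕ) : intChoose n 2 * 2 = n * (n - 1) := by
  have := intChoose_absorb n 1
  rw [intChoose_one_right] at this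
  simpa using this

theorem commonCount_one_ge (n q : ℕ) (t d : ℤ) :
    intChoose n t * (intChoose n (t - 1) * intChoose q (d + 1) + intChoose n t * intChoose q d
      + intChoose n (t + 1) * intChoose q (d - 1))
    + intChoose n (t - 1) * (intChoose n (t - 2) * intChoose q (d + 1)
      + intChoose n (t - 1) * intChoose q d + intChoose n t * intChoose q (d - 1))
    ≤ commonCount 1 n (n + q) t (t + d) := by
  rw [commonCount_one]
  have h1 := intChoose_add_ge n q t d
  have h2 := intChoose_add_ge n q (t - 1) d
  rw [show t - 1 - 1 = t - 2 by ring, sub_add_cancel, show t - 1 + d = t + d - 1 by ring] at h2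
  exact add_le_add (mul_le_mul_of_nonneg_left h1 (intChoose_nonneg _ _))
    (mul_le_mul_of_nonneg_left h2 (intChoose_nonneg _ _))

theorem commonCount_disjoint_ne {n q : ℕ} (hn : 2 ≤ n) (hq : 2 ≤ q) {t : ℤ} (ht : 1 ≤ t)
    (htn : t ≤ n) (hex : ¬(n = 2 ∧ q = 4 ∧ t = 1)) :
    commonCount (n + 1) 0 q t (n + 1 - t) ≠ commonCount 1 n (n + q) t (n + 1 - t) := by
  obtain ⟨d, hd⟩ : ∃ d : ℤ, d = n + 1 - 2 * t := ⟨_, rfl⟩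
  have hi : (n : ℤ) + 1 - t = t + d := by omega
  rw [hi, commonCount_zero_left, add_sub_cancel_left, intChoose_succ]
  have hge := commonCount_one_ge n q t d
  have hN := intChoose_nonneg n
  have a1 := intChoose_absorb n t
  have a2 := intChoose_absorb n (t - 1)
  have a3 := intChoose_absorb n (t - 2)
  rw [sub_add_cancel] at a2
  rw [show t - 2 + 1 = t - 1 by ring] at a3
  have hu : 0 < intChoose n t := intChoose_pos (by omega) htn
  have hv : 0 < intChoose n (t - 1) := intChoose_pos (by omega) (by omega)
  have hpos : 0 < commonCount 1 n (n + q) t (t + d) := by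
    rw [commonCount_one]
    have := mul_pos hu (intChoose_pos (n := n + q) (z := t + d) (by omega) (by push_cast; omega))
    have := mul_nonneg hv.le (intChoose_nonneg (n + q) (t + d - 1))
    linarith
  have hw := hN (t - 2)
  rcases lt_or_ge d 0 with hd0 | hd0
  · rw [intChoose_of_neg q hd0, mul_zero]
    exact hpos.ne
  have hcases : d = 0 ∨ d = 1 ∨ 2 ≤ d := by omega
  rcases hcases with rfl | rfl | hd2
  · apply ne_of_lt
    refine lt_of_lt_of_le ?_ hge
    have huv : intChoose n t = intChoose n (t - 1) := by
      apply mul_right_cancel₀ (show t ≠ 0 by omega)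
      rw [a2]; congr 1; omega
    have hw : 0 < intChoose n (t - 2) := intChoose_pos (by omega) (by omega)
    rw [huv, zero_add, zero_sub, intChoose_zero_right, intChoose_one_right,
      intChoose_of_neg q (by norm_num)]
    have : (2 : ℤ) ≤ q := by exact_mod_cast hq
    nlinarith [mul_pos hv hw, mul_pos hv hv]
  · have hn2 : (n : ℤ) = 2 * t := by omega
    have hcv : intChoose n (t + 1) = intChoose n (t - 1) := by
      have : (t + 1) * t ≠ 0 := by apply mul_ne_zero <;> omega
      apply mul_right_cancel₀ this
      rw [hn2] at a1 a2
      linear_combination t * a1 + t * a2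
    rw [hcv, one_add_one_eq_two, sub_self, intChoose_zero_right, intChoose_one_right] at hge
    rw [intChoose_one_right]
    rw [hn2] at a2 a3
    have s2 (z : ℤ) :
        intChoose (n + 2) z = intChoose n z + 2 * intChoose n (z - 1) + intChoose n (z - 2) := by
      rw [show n + 2 = (n + 1) + 1 from rfl, intChoose_succ (n + 1), intChoose_succ n,
        intChoose_succ n, show z - 1 - 1 = z - 2 by ring]
      ring
    have hcases : q = 2 ∨ q = 3 ∨ 4 ≤ q := by omega
    rcases hcases with rfl | rfl | hq4
    · rw [commonCount_one, s2, s2, add_sub_cancel_right, show t + 1 - 2 = t - 1 by ring, hcv]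
      have hwu : intChoose n (t - 2) < intChoose n t := by nlinarith
      have := mul_pos hv (sub_pos.2 hwu)
      apply ne_of_gt
      push_cast
      linarith
    · have a4 := intChoose_absorb n (t - 3)
      rw [show t - 3 + 1 = t - 2 by ring, hn2] at a4
      rw [commonCount_one, intChoose_succ (n + 2), intChoose_succ (n + 2), s2, s2, s2,
        add_sub_cancel_right, show t + 1 - 2 = t - 1 by ring,
        show t - 1 - 1 = t - 2 by ring, show t - 1 - 2 = t - 3 by ring, hcv]
      intro h
      have hz : intChoose n t ^ 2 * (t * (2 * t + 1) * (2 * t ^ 2 - t - 9)) = 0 := by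
        push_cast at h
        generalize intChoose n t = u at *
        generalize intChoose n (t - 1) = v at *
        generalize intChoose n (t - 2) = w at *
        generalize intChoose n (t - 3) = x at *
        have hV : v * (t + 1) = u * t := by linear_combination -a2
        have hW : w * ((t + 1) * (t + 2)) = u * (t * (t - 1)) := by
          linear_combination (t - 1) * hV - (t + 1) * a3
        have hX : x * ((t + 1) * (t + 2) * (t + 3)) = u * (t * (t - 1) * (t - 2)) := by
          linear_combination (t - 2) * hW - (t + 1) * (t + 2) * a4
        linear_combination (-((t + 1) ^ 2 * (t + 2) * (t + 3))) * h
          + u * (t + 1) * (t + 2) * (t + 3) * hV - u * (t + 1) * (t + 3) * hW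
          - 3 * (t + 3) * (w * ((t + 1) * (t + 2)) * hV + u * t * hW)
          - (x * ((t + 1) * (t + 2) * (t + 3)) * hV + u * t * hX)
      have h1 : t * (2 * t + 1) * (2 * t ^ 2 - t - 9) ≠ 0 := by
        refine mul_ne_zero (mul_ne_zero (by omega) (by omega)) ?_
        rcases le_or_gt t 2 with h2 | h2
        · apply ne_of_lt; nlinarith
        · apply ne_of_gt; nlinarith
      exact mul_ne_zero (pow_ne_zero 2 hu.ne') h1 hz
    · apply ne_of_lt
      refine lt_of_lt_of_le ?_ hge
      have hQ := two_mul_intChoose_two q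
      have hq4' : (4 : ℤ) ≤ q := by exact_mod_cast hq4
      have huv := mul_pos hu hv
      suffices 0 < intChoose n (t - 1) * (intChoose n t * (((q : ℤ) - 1) * (q - 4))
          + intChoose n (t - 2) * (q * (q - 1))) by
        have e1 := congrArg (intChoose n (t - 1) * intChoose n t * ·) hQ
        have e2 := congrArg (intChoose n (t - 1) * intChoose n (t - 2) * ·) hQ
        linarith
      apply mul_pos hv
      have hqq : 0 < (q : ℤ) * (q - 1) := by apply mul_pos <;> omega
      rcases eq_or_ne t 1 with rfl | ht1
      · have : 0 < ((q : ℤ) - 1) * (q - 4) := by apply mul_pos <;> omega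
        exact add_pos_of_pos_of_nonneg (mul_pos hu this) (mul_nonneg hw hqq.le)
      · have : 0 ≤ ((q : ℤ) - 1) * (q - 4) := by apply mul_nonneg <;> omega
        exact add_pos_of_nonneg_of_pos (mul_nonneg hu.le this)
          (mul_pos (intChoose_pos (by omega) (by omega)) hqq)
  · apply ne_of_lt
    rcases le_or_gt d q with hdq | hdq
    · refine lt_of_lt_of_le ?_ hge
      have hcv : intChoose n (t - 1) < intChoose n (t + 1) := by
        have hp : 0 < (t + 1) * t := by apply mul_pos <;> omega
        have e : intChoose n (t + 1) * ((t + 1) * t)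
            = intChoose n (t - 1) * ((t + d) * (t + d - 1)) := by
          have : (n : ℤ) = 2 * t + d - 1 := by omega
          rw [this] at a1 a2
          linear_combination t * a1 + (t + d - 1) * a2
        by_contra! hle
        have := mul_le_mul_of_nonneg_right hle hp.le
        rw [e] at this
        have := le_of_mul_le_mul_left this hv
        nlinarith
      have hQ := two_mul_intChoose_le q hd2
      have hQm : 0 < intChoose q (d - 1) := intChoose_pos (by omega) (by omega)
      have hQp := intChoose_nonneg q (d + 1)
      have m1 := mul_le_mul_of_nonneg_left hQ (mul_pos hu hv).le
      have m2 := mul_pos (mul_pos hu hQm) (sub_pos.2 hcv)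
      have m3 := mul_nonneg (mul_nonneg hv.le hw) hQp
      nlinarith
    · rw [intChoose_of_gt q hdq, mul_zero]
      exact hpos

theorem card_filter_powerset_card {α : Type*} (S : Finset α) (z : ℤ) :
    ((S.powerset.filter fun Z => (Z.card : ℤ) = z).card : ℤ) = intChoose S.card z := by
  by_cases hz : 0 ≤ z
  · lift z to ℕ using hz
    rw [intChoose_natCast, ← Finset.card_powersetCard, Finset.powersetCard_eq_filter]
    simp
  · rw [intChoose_of_neg _ (by omega), Finset.filter_false_of_mem (fun Z _ => by omega)]
    simp

section Counting

variable {α : Type*} [DecidableEq α]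

theorem card_filter_powerset_union {S T : Finset α} (hST : Disjoint S T)
    (P Q : Finset α → Prop) [DecidablePred P] [DecidablePred Q] :
    ((S ∪ T).powerset.filter fun Z => P (Z ∩ S) ∧ Q (Z ∩ T)).card
      = (S.powerset.filter P).card * (T.powerset.filter Q).card := by
  rw [← Finset.card_product]
  have hS {U V : Finset α} (hU : U ⊆ S) (hV : V ⊆ T) : (U ∪ V) ∩ S = U := by
    rw [Finset.union_inter_distrib_right, Finset.inter_eq_left.2 hU,
      Finset.disjoint_iff_inter_eq_empty.1 (hST.symm.mono_left hV), Finset.union_empty]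
  have hT {U V : Finset α} (hU : U ⊆ S) (hV : V ⊆ T) : (U ∪ V) ∩ T = V := by
    rw [Finset.union_inter_distrib_right, Finset.inter_eq_left.2 hV,
      Finset.disjoint_iff_inter_eq_empty.1 (hST.mono_left hU), Finset.empty_union]
  refine Finset.card_nbij' (fun Z => (Z ∩ S, Z ∩ T)) (fun W => W.1 ∪ W.2) ?_ ?_ ?_ ?_
  · intro Z hZ
    simp only [Finset.coe_filter, Finset.mem_powerset, Set.mem_ofPred_eq] at hZ
    simp [hZ.2.1, hZ.2.2]
  · rintro ⟨U, V⟩ hW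
    simp only [Finset.coe_product, Finset.coe_filter, Finset.mem_powerset, Set.mem_prod,
      Set.mem_ofPred_eq] at hW
    obtain ⟨⟨hU, hPU⟩, hV, hQV⟩ := hW
    simp only [Finset.coe_filter, Finset.mem_powerset, Set.mem_ofPred_eq, hS hU hV, hT hU hV]
    exact ⟨Finset.union_subset_union hU hV, hPU, hQV⟩
  · intro Z hZ
    simp only [Finset.coe_filter, Finset.mem_powerset, Set.mem_ofPred_eq] at hZ
    simp only [← Finset.inter_union_distrib_left]
    exact Finset.inter_eq_left.2 hZ.1
  · rintro ⟨U, V⟩ hW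
    simp only [Finset.coe_product, Finset.coe_filter, Finset.mem_powerset, Set.mem_prod,
      Set.mem_ofPred_eq] at hW
    simp [hS hW.1.1 hW.2.1, hT hW.1.1 hW.2.1]

theorem card_filter_four_parts [Fintype α] {A B C D : Finset α} (hAB : Disjoint A (B ∪ (C ∪ D)))
    (hBC : Disjoint B (C ∪ D)) (hCD : Disjoint C D) (hU : A ∪ (B ∪ (C ∪ D)) = Finset.univ)
    (a b c d : ℤ) :
    ((Finset.univ.filter fun Z : Finset α => ((Z ∩ A).card : ℤ) = a ∧ ((Z ∩ B).card : ℤ) = b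
        ∧ ((Z ∩ C).card : ℤ) = c ∧ ((Z ∩ D).card : ℤ) = d).card : ℤ)
      = intChoose A.card a * (intChoose B.card b * (intChoose C.card c * intChoose D.card d)) := by
  rw [← card_filter_powerset_card A, ← card_filter_powerset_card B,
    ← card_filter_powerset_card C, ← card_filter_powerset_card D]
  norm_cast
  rw [← card_filter_powerset_union hCD, ← card_filter_powerset_union hBC,
    ← card_filter_powerset_union hAB, hU, Finset.powerset_univ]
  have h0 (Z : Finset α) : Z ∩ Finset.univ = Z := Finset.inter_univ Z
  refine congrArg Finset.card (Finset.filter_congr fun Z _ => ?_)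
  rw [← hU] at h0
  have h1 : Z ∩ (B ∪ (C ∪ D)) ∩ B = Z ∩ B := by grind
  have h2 : Z ∩ (B ∪ (C ∪ D)) ∩ (C ∪ D) ∩ C = Z ∩ C := by grind
  have h3 : Z ∩ (B ∪ (C ∪ D)) ∩ (C ∪ D) ∩ D = Z ∩ D := by grind
  simp only [h1, h2, h3]

theorem card_common_eq_commonCount [Fintype α] {X Y : Finset α} (hXY : X.card = Y.card)
    (t i : ℤ) :
    ((Finset.univ.filter fun Z : Finset α => ((Z ∩ X).card : ℤ) = t ∧ ((Z ∩ Y).card : ℤ) = t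
        ∧ ((Z \ X).card : ℤ) = i).card : ℤ)
      = commonCount (X \ Y).card (X ∩ Y).card (X ∪ Y)ᶜ.card t i := by
  have hj : (Y \ X).card = (X \ Y).card := by
    have h1 := Finset.card_sdiff_add_card_inter X Y
    have h2 := Finset.card_sdiff_add_card_inter Y X
    rw [Finset.inter_comm] at h2
    omega
  unfold commonCount
  rw [Finset.card_eq_sum_card_fiberwise (f := fun Z => (Z ∩ (X \ Y)).card)
    (t := Finset.range ((X \ Y).card + 1))]
  · push_cast
    refine Finset.sum_congr rfl fun h _ => ?_
    have := card_filter_four_parts (A := X \ Y) (B := Y \ X) (C := X ∩ Y) (D := (X ∪ Y)ᶜ)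
      (Finset.disjoint_left.2 fun x => by simp; tauto)
      (Finset.disjoint_left.2 fun x => by simp; tauto)
      (Finset.disjoint_left.2 fun x => by simp; tauto)
      (Finset.ext fun x => by simp; tauto) h h (t - h) (i - h)
    rw [hj] at this
    rw [pow_two, mul_assoc, mul_assoc, ← this, Finset.filter_filter]
    congr 2
    ext Z
    simp only [Finset.mem_filter, Finset.mem_univ, true_and]
    have e1 : (Z ∩ X).card = (Z ∩ (X \ Y)).card + (Z ∩ (X ∩ Y)).card := by
      rw [← Finset.card_union_of_disjoint (Finset.disjoint_left.2 fun x => by simp; tauto)]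
      congr 1; ext x; simp; tauto
    have e2 : (Z ∩ Y).card = (Z ∩ (Y \ X)).card + (Z ∩ (X ∩ Y)).card := by
      rw [← Finset.card_union_of_disjoint (Finset.disjoint_left.2 fun x => by simp; tauto)]
      congr 1; ext x; simp; tauto
    have e3 : (Z \ X).card = (Z ∩ (Y \ X)).card + (Z ∩ (X ∪ Y)ᶜ).card := by
      rw [← Finset.card_union_of_disjoint (Finset.disjoint_left.2 fun x => by simp; tauto)]
      congr 1; ext x; simp; tauto
    rw [e1, e2, e3]
    push_cast
    constructor <;> intro H <;> refine ⟨?_, ?_⟩ <;> omega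
  · intro Z _
    simp only [Finset.coe_range, Set.mem_Iio]
    exact Nat.lt_succ_of_le (Finset.card_le_card Finset.inter_subset_right)

end Counting

section Action

variable {α : Type*}

theorem natCard_subtype_card_eq [Fintype α] (k : ℕ) (P : Finset α → Prop) [DecidablePred P] :
    Nat.card {X : {S : Finset α // S.card = k} // P X.val}
      = ((Finset.powersetCard k Finset.univ).filter P).card := by
  rw [← Nat.subtype_card _ (fun _ => Iff.rfl)]
  exact Nat.card_congr ⟨fun U => ⟨U.1.1, by simpa using ⟨U.1.2, U.2⟩⟩,
    fun U => ⟨⟨U.1, Finset.mem_powersetCard_univ.1 (Finset.mem_filter.1 U.2).1⟩,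
      (Finset.mem_filter.1 U.2).2⟩, fun U => rfl, fun U => rfl⟩

/-- The permutation of the `k`-subsets of `α` induced by a permutation of `α`. -/
def subsetPerm (k : ℕ) (σ : Equiv.Perm α) : Equiv.Perm {S : Finset α // S.card = k} :=
  σ.finsetCongr.subtypeEquiv fun S => by simp

theorem coe_subsetPerm {k : ℕ} (σ : Equiv.Perm α) (X : {S : Finset α // S.card = k}) :
    (subsetPerm k σ X).val = X.val.map σ.toEmbedding := rfl

theorem card_inter_subsetPerm [DecidableEq α] {k : ℕ} (σ : Equiv.Perm α) (X Y : {S : Finset α // S.card = k}) :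
    ((subsetPerm k σ X).val ∩ (subsetPerm k σ Y).val).card = (X.val ∩ Y.val).card := by
  rw [coe_subsetPerm, coe_subsetPerm, ← Finset.map_inter, Finset.card_map]

theorem exists_perm_map_eq_of_card_eq [DecidableEq α] [Fintype α] {X Y Z X' Y' Z' : Finset α}
    (hX : X.card = X'.card) (hY : Y.card = Y'.card) (hZ : Z.card = Z'.card)
    (hXY : (X ∩ Y).card = (X' ∩ Y').card) (hXZ : (X ∩ Z).card = (X' ∩ Z').card)
    (hYZ : (Y ∩ Z).card = (Y' ∩ Z').card) (hXYZ : (X ∩ Y ∩ Z).card = (X' ∩ Y' ∩ Z').card) :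
    ∃ σ : Equiv.Perm α, X.map σ.toEmbedding = X' ∧ Y.map σ.toEmbedding = Y' ∧
      Z.map σ.toEmbedding = Z' := by
  let part (b : Bool) (S : Finset α) : Finset α := if b then S else Sᶜ
  have hcompl (S T : Finset α) : (S ∩ Tᶜ).card + (S ∩ T).card = S.card := by
    rw [← Finset.sdiff_eq_inter_compl, Finset.card_sdiff_add_card_inter]
  have hcompl' (S T U : Finset α) : (S ∩ Tᶜ ∩ U).card + (S ∩ T ∩ U).card = (S ∩ U).card := by
    rw [Finset.inter_right_comm, Finset.inter_right_comm S T, hcompl]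
  have hcompl'' (S T : Finset α) : (Sᶜ ∩ T).card + (S ∩ T).card = T.card := by
    rw [Finset.inter_comm, Finset.inter_comm S T, hcompl]
  have hcompl3 (S T U : Finset α) : (Sᶜ ∩ T ∩ U).card + (S ∩ T ∩ U).card = (T ∩ U).card := by
    rw [Finset.inter_assoc, Finset.inter_assoc, hcompl'']
  have hc (S : Finset α) : Sᶜ.card + S.card = Fintype.card α := by
    rw [add_comm, Finset.card_add_card_compl]
  have hfib (b : Bool × Bool × Bool) :
      (part b.1 X ∩ part b.2.1 Y ∩ part b.2.2 Z).card
        = (part b.1 X' ∩ part b.2.1 Y' ∩ part b.2.2 Z').card := by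
    have key (X Y Z : Finset α) := And.intro (hcompl (X ∩ Y) Z) <|
      And.intro (hcompl (Xᶜ ∩ Y) Z) <| And.intro (hcompl (X ∩ Yᶜ) Z) <|
      And.intro (hcompl (Xᶜ ∩ Yᶜ) Z) <| And.intro (hcompl' X Y Z) <|
      And.intro (hcompl' Xᶜ Y Z) <| And.intro (hcompl3 X Y Z) <|
      And.intro (hcompl'' X Y) <| And.intro (hcompl'' X Z) <| And.intro (hcompl X Y) <|
      And.intro (hcompl Xᶜ Y) <| hc X
    have k1 := key X Y Z
    have k2 := key X' Y' Z'
    obtain ⟨_ | _, _ | _, _ | _⟩ := b <;> simp only [part, if_true, Bool.false_eq_true, if_false] <;>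
      omega
  let c (X Y Z : Finset α) (a : α) : Bool × Bool × Bool :=
    (decide (a ∈ X), decide (a ∈ Y), decide (a ∈ Z))
  have hpart (b : Bool) (S : Finset α) (a : α) : a ∈ part b S ↔ decide (a ∈ S) = b := by
    cases b <;> simp [part]
  have hcard (X Y Z : Finset α) (b : Bool × Bool × Bool) :
      Fintype.card {a // c X Y Z a = b} = (part b.1 X ∩ part b.2.1 Y ∩ part b.2.2 Z).card := by
    rw [Fintype.card_subtype]
    congr 1
    ext a
    simp [hpart, c, Prod.ext_iff]
  let σ : Equiv.Perm α := Equiv.ofFiberEquiv (f := c X Y Z) (g := c X' Y' Z') fun b =>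
    Fintype.equivOfCardEq (by rw [hcard, hcard, hfib])
  have hσ (a : α) : c X' Y' Z' (σ a) = c X Y Z a := Equiv.ofFiberEquiv_map _ a
  simp only [c, Prod.mk.injEq, decide_eq_decide] at hσ
  refine ⟨σ, ?_, ?_, ?_⟩ <;> ext a <;> obtain ⟨a, rfl⟩ := σ.surjective a <;> simp [hσ]

end Action

section Automorphisms

variable {m k i : ℕ}

theorem IsDigraphAut.symm {V : Type*} {A : V → V → Prop} {g : Equiv.Perm V}
    (hg : IsDigraphAut A g) : IsDigraphAut A g.symm := fun u v => by
  rw [hg (g.symm u), g.apply_symm_apply, g.apply_symm_apply]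

theorem isDigraphAut_subsetPerm (σ : Equiv.Perm (Fin m)) :
    IsDigraphAut (johnsonAdj m k i) (subsetPerm k σ) := fun X Y => by
  rw [johnsonAdj, johnsonAdj, card_inter_subsetPerm]

theorem IsDigraphAut.card_common_eq {V : Type*} {A : V → V → Prop} {g : Equiv.Perm V}
    (hg : IsDigraphAut A g) (u v : V) :
    Nat.card {w // A u w ∧ A v w} = Nat.card {w // A (g u) w ∧ A (g v) w} :=
  Nat.card_congr (g.subtypeEquiv fun w => and_congr (hg u w) (hg v w))

theorem IsDigraphAut.card_common_three_eq {V : Type*} {A : V → V → Prop} {g : Equiv.Perm V}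
    (hg : IsDigraphAut A g) (u v w : V) :
    Nat.card {x // A u x ∧ A v x ∧ A w x} = Nat.card {x // A (g u) x ∧ A (g v) x ∧ A (g w) x} :=
  Nat.card_congr (g.subtypeEquiv fun x => and_congr (hg u x) (and_congr (hg v x) (hg w x)))

theorem card_common_johnsonAdj (hik : i ≤ k) (X Y : {S : Finset (Fin m) // S.card = k}) {j : ℕ}
    (hj : (X.val ∩ Y.val).card + j = k) :
    (Nat.card {Z // johnsonAdj m k i X Z ∧ johnsonAdj m k i Y Z} : ℤ)
      = commonCount j (k - j) (m - k - j) ((k : ℤ) - i) i := by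
  obtain ⟨X, hX⟩ := X
  obtain ⟨Y, hY⟩ := Y
  simp only at hj
  have h1 : (X \ Y).card = j := by
    have := Finset.card_sdiff_add_card_inter X Y
    omega
  have h2 : (X ∩ Y).card = k - j := by omega
  have h3 : (X ∪ Y)ᶜ.card = m - k - j := by
    have := Finset.card_union_add_card_inter X Y
    rw [Finset.card_compl, Fintype.card_fin]
    omega
  have := card_common_eq_commonCount (hX.trans hY.symm) ((k : ℤ) - i) i
  rw [h1, h2, h3] at this
  rw [← this, ← Fintype.card_subtype, ← Nat.card_eq_fintype_card]
  congr 1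
  refine Nat.card_congr ⟨fun Z => ⟨Z.1.1, ?_⟩, fun Z => ⟨⟨Z.1, ?_⟩, ?_⟩, fun Z => rfl, fun Z => rfl⟩
  · obtain ⟨⟨Z, hZ⟩, hXZ, hYZ⟩ := Z
    simp only [johnsonAdj] at hXZ hYZ ⊢
    rw [Finset.inter_comm] at hXZ hYZ
    have := Finset.card_sdiff_add_card_inter Z X
    omega
  · have := Finset.card_sdiff_add_card_inter Z.1 X
    have := Z.2
    omega
  · have := Z.2
    simp only [johnsonAdj]
    rw [Finset.inter_comm, Finset.inter_comm Y]
    omega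

/-- Outside of one exceptional case, automorphisms of a distance-`i` Johnson graph preserve the
relation of meeting in `k - 1` elements. -/
theorem IsDigraphAut.card_inter_of_ne (hi : 0 < i) (hik : i < k) (hk : 3 ≤ k)
    (hm : 2 * k + 2 ≤ m) {g : Equiv.Perm {S : Finset (Fin m) // S.card = k}}
    (hg : IsDigraphAut (johnsonAdj m k i) g) {X Y : {S : Finset (Fin m) // S.card = k}}
    (hXY : (X.val ∩ Y.val).card = k - 1)
    (hex : m = 10 → k = 3 → i = 2 → ((g X).val ∩ (g Y).val).card ≠ 0) :
    ((g X).val ∩ (g Y).val).card = k - 1 := by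
  have hcount := hg.card_common_eq X Y
  obtain ⟨j, hj⟩ : ∃ j, ((g X).val ∩ (g Y).val).card + j = k :=
    ⟨k - ((g X).val ∩ (g Y).val).card, by
      have := Finset.card_le_card (Finset.inter_subset_left (s₁ := (g X).val) (s₂ := (g Y).val))
      have := (g X).2
      omega⟩
  have h1 := card_common_johnsonAdj hik.le X Y (j := 1) (by omega)
  have h2 := card_common_johnsonAdj hik.le (g X) (g Y) hj
  rw [hcount, h2] at h1
  have hj0 : j ≠ 0 := by
    rintro rfl
    have hX : g X = g Y := by
      have e1 := Finset.eq_of_subset_of_card_le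
        (Finset.inter_subset_left (s₁ := (g X).val) (s₂ := (g Y).val)) (by have := (g X).2; omega)
      have e2 := Finset.eq_of_subset_of_card_le
        (Finset.inter_subset_right (s₁ := (g X).val) (s₂ := (g Y).val)) (by have := (g Y).2; omega)
      exact Subtype.ext (e1.symm.trans e2)
    rw [g.injective hX, Finset.inter_self, Y.2] at hXY
    omega
  have hj2 : ¬ (2 ≤ j ∧ j < k) := by
    rintro ⟨hj2, hjk⟩
    have := commonCount_lt_one hj2 (k - j - 1) (m - k - j - 3) (t := (k : ℤ) - i) (i := i)
      (by omega) (by omega) (by omega) (by omega)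
    rw [show k - j - 1 + 1 = k - j by omega, show m - k - j - 3 + 3 = m - k - j by omega,
      show k - j - 1 + j = k - 1 by omega, show m - k - j - 3 + j + 2 = m - k - 1 by omega] at this
    omega
  have hjk : j ≠ k := by
    intro hjk
    have := commonCount_disjoint_ne (n := k - 1) (q := m - 2 * k) (by omega) (by omega)
      (t := (k : ℤ) - i) (by omega) (by omega) (fun h => hex (by omega) (by omega) (by omega)
        (by omega))
    rw [show k - 1 + 1 = j by omega, show k - 1 + (m - 2 * k) = m - k - 1 by omega,
      show ((k - 1 : ℕ) : ℤ) + 1 - (k - i) = i by omega] at this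
    rw [show k - j = 0 by omega, show m - k - j = m - 2 * k by omega] at h1
    exact this h1
  omega

theorem exists_subsetPerm_of_card_inter {X Y Z X' Y' Z' : {S : Finset (Fin m) // S.card = k}}
    (hXY : (X.val ∩ Y.val).card = (X'.val ∩ Y'.val).card)
    (hXZ : (X.val ∩ Z.val).card = (X'.val ∩ Z'.val).card)
    (hYZ : (Y.val ∩ Z.val).card = (Y'.val ∩ Z'.val).card)
    (hXYZ : (X.val ∩ Y.val ∩ Z.val).card = (X'.val ∩ Y'.val ∩ Z'.val).card) :
    ∃ σ : Equiv.Perm (Fin m), subsetPerm k σ X = X' ∧ subsetPerm k σ Y = Y' ∧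
      subsetPerm k σ Z = Z' := by
  obtain ⟨σ, h⟩ := exists_perm_map_eq_of_card_eq (X.2.trans X'.2.symm) (Y.2.trans Y'.2.symm)
    (Z.2.trans Z'.2.symm) hXY hXZ hYZ hXYZ
  exact ⟨σ, Subtype.ext h.1, Subtype.ext h.2.1, Subtype.ext h.2.2⟩

theorem card_common_three_johnsonAdj (X Y Z : {S : Finset (Fin m) // S.card = k}) :
    Nat.card {U // johnsonAdj m k i X U ∧ johnsonAdj m k i Y U ∧ johnsonAdj m k i Z U}
      = ((Finset.powersetCard k Finset.univ).filter fun U => (X.val ∩ U).card = k - i ∧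
          (Y.val ∩ U).card = k - i ∧ (Z.val ∩ U).card = k - i).card :=
  natCard_subtype_card_eq k fun U => (X.val ∩ U).card = k - i ∧ (Y.val ∩ U).card = k - i ∧
    (Z.val ∩ U).card = k - i

theorem card_common_three_johnsonAdj_of_disjoint {X Y Z : {S : Finset (Fin 10) // S.card = 3}}
    (hXY : (X.val ∩ Y.val).card = 0) (hXZ : johnsonAdj 10 3 2 X Z) (hYZ : johnsonAdj 10 3 2 Y Z) :
    Nat.card {U // johnsonAdj 10 3 2 X U ∧ johnsonAdj 10 3 2 Y U ∧ johnsonAdj 10 3 2 Z U} = 16 := by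
  obtain ⟨σ, hX, hY, hZ⟩ := exists_subsetPerm_of_card_inter (X := X) (Y := Y) (Z := Z)
    (X' := ⟨{0, 1, 2}, rfl⟩) (Y' := ⟨{3, 4, 5}, rfl⟩) (Z' := ⟨{0, 3, 6}, rfl⟩)
    hXY hXZ hYZ (by
      rw [Finset.card_eq_zero] at hXY
      rw [hXY, Finset.empty_inter]
      rfl)
  rw [(isDigraphAut_subsetPerm σ).card_common_three_eq, hX, hY, hZ, card_common_three_johnsonAdj]
  decide +kernel

theorem exists_card_common_three_johnsonAdj {X Y : {S : Finset (Fin 10) // S.card = 3}}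
    (hXY : (X.val ∩ Y.val).card = 2) : ∃ Z, johnsonAdj 10 3 2 X Z ∧ johnsonAdj 10 3 2 Y Z ∧
      Nat.card {U // johnsonAdj 10 3 2 X U ∧ johnsonAdj 10 3 2 Y U ∧ johnsonAdj 10 3 2 Z U}
        = 10 := by
  obtain ⟨σ, hX, hY, -⟩ := exists_perm_map_eq_of_card_eq (X := X.val) (Y := Y.val) (Z := ∅)
    (X' := ({0, 1, 2} : Finset (Fin 10))) (Y' := {0, 1, 3}) (Z' := ∅) X.2 Y.2 rfl hXY
    (by simp) (by simp) (by simp)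
  obtain ⟨Z, hZ⟩ := (subsetPerm 3 σ).surjective ⟨{2, 3, 4}, rfl⟩
  replace hX : subsetPerm 3 σ X = ⟨{0, 1, 2}, rfl⟩ := Subtype.ext hX
  replace hY : subsetPerm 3 σ Y = ⟨{0, 1, 3}, rfl⟩ := Subtype.ext hY
  refine ⟨Z, ?_, ?_, ?_⟩
  · rw [isDigraphAut_subsetPerm σ, hX, hZ]
    rfl
  · rw [isDigraphAut_subsetPerm σ, hY, hZ]
    rfl
  · rw [(isDigraphAut_subsetPerm σ).card_common_three_eq, hX, hY, hZ, card_common_three_johnsonAdj]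
    decide +kernel

/-- Automorphisms of a distance-`i` Johnson graph are automorphisms of the Johnson graph. -/
theorem IsDigraphAut.johnsonAdj_one (hi : 0 < i) (hik : i < k) (hm : 2 * k + 2 ≤ m)
    {g : Equiv.Perm {S : Finset (Fin m) // S.card = k}}
    (hg : IsDigraphAut (johnsonAdj m k i) g) : IsDigraphAut (johnsonAdj m k 1) g := by
  obtain rfl | hi1 := eq_or_ne i 1
  · exact hg
  have key {g : Equiv.Perm {S : Finset (Fin m) // S.card = k}}
      (hg : IsDigraphAut (johnsonAdj m k i) g) (X Y : {S : Finset (Fin m) // S.card = k})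
      (hXY : (X.val ∩ Y.val).card = k - 1) : ((g X).val ∩ (g Y).val).card = k - 1 := by
    refine hg.card_inter_of_ne hi hik (by omega) hm hXY ?_
    rintro rfl rfl rfl h0
    obtain ⟨Z, hXZ, hYZ, hZ⟩ := exists_card_common_three_johnsonAdj hXY
    rw [hg.card_common_three_eq, card_common_three_johnsonAdj_of_disjoint h0
      ((hg _ _).1 hXZ) ((hg _ _).1 hYZ)] at hZ
    omega
  refine fun X Y => ⟨key hg X Y, fun h => ?_⟩
  have := key hg.symm _ _ h
  rwa [g.symm_apply_apply, g.symm_apply_apply] at this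

end Automorphisms

section Johnson

theorem exists_eq_subsetPerm_one {α : Type*} [Finite α] (g : Equiv.Perm {S : Finset α // S.card = 1}) :
    ∃ σ : Equiv.Perm α, g = subsetPerm 1 σ := by
  have h (a : α) : ∃ b, (g ⟨{a}, Finset.card_singleton a⟩).val = {b} := Finset.card_eq_one.1 (g _).2
  choose f hf using h
  have hinj : Function.Injective f := fun a b hab => by
    have := hf a
    rw [hab, ← hf b] at this
    simpa using g.injective (Subtype.ext this)
  refine ⟨Equiv.ofBijective f (Finite.injective_iff_bijective.1 hinj), ?_⟩
  ext1 ⟨X, hX⟩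
  obtain ⟨a, rfl⟩ := Finset.card_eq_one.1 hX
  refine Subtype.ext ?_
  rw [hf, coe_subsetPerm]
  simp

variable {α : Type*} [DecidableEq α]

/-- A large clique of a Johnson graph consists of sets with a common subset of size one less. -/
theorem exists_common_subset_of_pairwise_card_inter {k : ℕ} {F : Finset (Finset α)}
    (hF : ∀ X ∈ F, X.card = k + 1) (hpair : ∀ X ∈ F, ∀ Y ∈ F, X ≠ Y → (X ∩ Y).card = k)
    (hcard : k + 3 ≤ F.card) : ∃ W : Finset α, W.card = k ∧ ∀ X ∈ F, W ⊆ X := by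
  obtain ⟨X, hX, Y, hY, hXY⟩ := Finset.one_lt_card.1 (show 1 < F.card by omega)
  refine ⟨X ∩ Y, hpair X hX Y hY hXY, ?_⟩
  by_contra! ⟨Z, hZ, hWZ⟩
  have hW := hpair X hX Y hY hXY
  have hunion := Finset.card_union_add_card_inter X Y
  rw [hF X hX, hF Y hY, hW] at hunion
  have hout {U : Finset α} (hU : U ∈ F) (hWU : ¬ X ∩ Y ⊆ U) : U ⊆ X ∪ Y := by
    have hUX : U ≠ X := by
      rintro rfl
      exact hWU Finset.inter_subset_left
    have hUY : U ≠ Y := by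
      rintro rfl
      exact hWU Finset.inter_subset_right
    have h1 := hpair U hU X hX hUX
    have h2 := hpair U hU Y hY hUY
    have h3 := Finset.card_union_add_card_inter (U ∩ X) (U ∩ Y)
    rw [← Finset.inter_union_distrib_left, ← Finset.inter_inter_distrib_left] at h3
    have h4 : (U ∩ (X ∩ Y)).card < (X ∩ Y).card := by
      refine Finset.card_lt_card (Finset.inter_subset_right.ssubset_of_ne fun h => hWU ?_)
      exact Finset.inter_eq_right.1 h
    have h5 := hF U hU
    exact Finset.inter_eq_left.1
      (Finset.eq_of_subset_of_card_le Finset.inter_subset_left (by omega))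
  have hsub : F ⊆ Finset.powersetCard (k + 1) (X ∪ Y) := by
    intro U hU
    refine Finset.mem_powersetCard.2 ⟨?_, hF U hU⟩
    by_cases hWU : X ∩ Y ⊆ U
    · intro u huU
      by_contra hu
      have huW : u ∉ X ∩ Y := fun h => hu (Finset.inter_subset_union h)
      have hU' : insert u (X ∩ Y) = U := by
        refine Finset.eq_of_subset_of_card_le (Finset.insert_subset huU hWU) ?_
        rw [Finset.card_insert_of_notMem huW, hF U hU, hW]
      have huZ : u ∉ Z := fun h => hu (hout hZ hWZ h)
      have h1 : U ∩ Z ⊂ X ∩ Y := by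
        rw [← hU', Finset.insert_inter_of_notMem huZ]
        refine Finset.inter_subset_left.ssubset_of_ne fun h => hWZ ?_
        exact Finset.inter_eq_left.1 h
      have h2 := Finset.card_lt_card h1
      have hUZ : U ≠ Z := by
        rintro rfl
        exact huZ huU
      rw [hpair U hU Z hZ hUZ, hW] at h2
      omega
    · exact hout hU hWU
  have := Finset.card_le_card hsub
  rw [Finset.card_powersetCard, show (X ∪ Y).card = (k + 1) + 1 by omega,
    Nat.choose_succ_self_right] at this
  omega

theorem card_inter_of_subset_of_ne {k : ℕ} {V W X : Finset α} (hV : V.card = k) (hW : W.card = k)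
    (hX : X.card = k + 1) (hVX : V ⊆ X) (hWX : W ⊆ X) (hVW : V ≠ W) : (V ∩ W).card = k - 1 := by
  have h1 := Finset.card_union_add_card_inter V W
  have h2 := Finset.card_le_card (Finset.union_subset hVX hWX)
  have h3 : (V ∩ W).card < V.card := by
    refine Finset.card_lt_card (Finset.inter_subset_left.ssubset_of_ne fun h => hVW ?_)
    exact Finset.eq_of_subset_of_card_le (Finset.inter_eq_left.1 h) (by omega)
  omega

variable [Fintype α]

theorem card_filter_supersets {k : ℕ} {W : Finset α} (hW : W.card = k) :
    Fintype.card α - k ≤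
      (Finset.univ.filter fun X : {S : Finset α // S.card = k + 1} => W ⊆ X.val).card := by
  rw [← hW, ← Finset.card_compl, ← Fintype.card_coe, ← Finset.card_univ]
  refine Finset.card_le_card_of_injOn
    (fun a => ⟨insert a.1 W, by
      rw [Finset.card_insert_of_notMem (Finset.mem_compl.1 a.2)]⟩) ?_ ?_
  · intro a _
    simp
  · intro a _ b _ hab
    have ha : a.1 ∈ insert b.1 W := by
      have hab' : insert a.1 W = insert b.1 W := congrArg Subtype.val hab
      rw [← hab']
      exact Finset.mem_insert_self _ _
    exact Subtype.ext ((Finset.mem_insert.1 ha).resolve_right (Finset.mem_compl.1 a.2))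

theorem exists_subset_image_of_card_inter {k : ℕ} (hm : 2 * k + 3 ≤ Fintype.card α)
    {g : Equiv.Perm {S : Finset α // S.card = k + 1}}
    (hg : ∀ X Y, (X.val ∩ Y.val).card = k → ((g X).val ∩ (g Y).val).card = k)
    (W : {S : Finset α // S.card = k}) :
    ∃ W' : {S : Finset α // S.card = k}, ∀ X, W.val ⊆ X.val → W'.val ⊆ (g X).val := by
  let F : Finset (Finset α) := (Finset.univ.filter fun X : {S : Finset α // S.card = k + 1} =>
    W.val ⊆ X.val).map (g.toEmbedding.trans (Function.Embedding.subtype _))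
  have hF {X} (hX : W.val ⊆ X.val) : (g X).val ∈ F :=
    Finset.mem_map.2 ⟨X, by simpa using hX, rfl⟩
  have hFk : ∀ X ∈ F, X.card = k + 1 := by
    intro X hX
    obtain ⟨X, -, rfl⟩ := Finset.mem_map.1 hX
    exact (g X).2
  have hpair : ∀ X ∈ F, ∀ Y ∈ F, X ≠ Y → (X ∩ Y).card = k := by
    intro X hX Y hY hXY
    obtain ⟨X, hWX, rfl⟩ := Finset.mem_map.1 hX
    obtain ⟨Y, hWY, rfl⟩ := Finset.mem_map.1 hY
    have hXY' : X ≠ Y := by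
      rintro rfl
      exact hXY rfl
    replace hWX := (Finset.mem_filter.1 hWX).2
    replace hWY := (Finset.mem_filter.1 hWY).2
    refine hg X Y (le_antisymm ?_ ?_)
    · have : (X.val ∩ Y.val).card < X.val.card := by
        refine Finset.card_lt_card (Finset.inter_subset_left.ssubset_of_ne fun h => hXY' ?_)
        exact Subtype.ext (Finset.eq_of_subset_of_card_le (Finset.inter_eq_left.1 h)
          (by rw [X.2, Y.2]))
      rw [X.2] at this
      omega
    · exact W.2.ge.trans (Finset.card_le_card (Finset.subset_inter hWX hWY))
  have hcard : k + 3 ≤ F.card := by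
    rw [Finset.card_map]
    refine le_trans ?_ (card_filter_supersets W.2)
    omega
  obtain ⟨W', hW', h⟩ := exists_common_subset_of_pairwise_card_inter hFk hpair hcard
  exact ⟨⟨W', hW'⟩, fun X hX => h _ (hF hX)⟩

theorem eq_of_forall_superset {k : ℕ} (hm : k + 2 ≤ Fintype.card α)
    {V W : {S : Finset α // S.card = k}}
    (h : ∀ X : {S : Finset α // S.card = k + 1}, W.val ⊆ X.val → V.val ⊆ X.val) : V = W := by
  refine Subtype.ext (Finset.eq_of_subset_of_card_le (fun a ha => ?_) (by rw [V.2, W.2]))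
  by_contra haW
  obtain ⟨b, hb⟩ : (insert a W.val)ᶜ.Nonempty := by
    rw [← Finset.card_pos, Finset.card_compl, Finset.card_insert_of_notMem haW, W.2]
    omega
  simp only [Finset.mem_compl, Finset.mem_insert, not_or] at hb
  have := h ⟨insert b W.val, by rw [Finset.card_insert_of_notMem hb.2, W.2]⟩
    (Finset.subset_insert _ _) ha
  rcases Finset.mem_insert.1 this with h | h
  · exact hb.1 h.symm
  · exact haW h

/-- Automorphisms of the Johnson graph are induced by permutations of the underlying set. -/
theorem exists_eq_subsetPerm {k : ℕ} (hm : 2 * k + 3 ≤ Fintype.card α)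
    (g : Equiv.Perm {S : Finset α // S.card = k + 1})
    (hg : ∀ X Y, (X.val ∩ Y.val).card = k ↔ ((g X).val ∩ (g Y).val).card = k) :
    ∃ σ : Equiv.Perm α, g = subsetPerm (k + 1) σ := by
  induction k with
  | zero => exact exists_eq_subsetPerm_one g
  | succ k ih =>
    have hg' (X Y) (h : (X.val ∩ Y.val).card = k + 1) :
        ((g.symm X).val ∩ (g.symm Y).val).card = k + 1 := by
      rwa [hg, g.apply_symm_apply, g.apply_symm_apply]
    choose f hf using exists_subset_image_of_card_inter hm fun X Y => (hg X Y).1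
    choose f' hf' using exists_subset_image_of_card_inter hm hg'
    have hleft (W) : f' (f W) = W := eq_of_forall_superset (by omega) fun X hX => by
      simpa using hf' _ _ (hf _ _ hX)
    have hright (W) : f (f' W) = W := eq_of_forall_superset (by omega) fun X hX => by
      simpa using hf _ _ (hf' _ _ hX)
    let e : Equiv.Perm {S : Finset α // S.card = k + 1} := ⟨f, f', hleft, hright⟩
    have key {g : Equiv.Perm {S : Finset α // S.card = k + 1 + 1}}
        {e : Equiv.Perm {S : Finset α // S.card = k + 1}}
        (he : ∀ W X, W.val ⊆ X.val → (e W).val ⊆ (g X).val) (V W)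
        (hVW : (V.val ∩ W.val).card = k) : ((e V).val ∩ (e W).val).card = k := by
      have hU : (V.val ∪ W.val).card = k + 1 + 1 := by
        have := Finset.card_union_add_card_inter V.val W.val
        rw [hVW, V.2, W.2] at this
        omega
      refine card_inter_of_subset_of_ne (e V).2 (e W).2 (g ⟨_, hU⟩).2
        (he V _ Finset.subset_union_left) (he W _ Finset.subset_union_right) fun h => ?_
      rw [e.injective (Subtype.ext h), Finset.inter_self, W.2] at hVW
      omega
    obtain ⟨σ, hσ⟩ := ih (by omega) e fun V W => ⟨key hf V W, fun h => by
      have := key (e := e.symm) hf' _ _ h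
      rwa [e.symm_apply_apply, e.symm_apply_apply] at this⟩
    refine ⟨σ, ?_⟩
    ext1 X
    refine (Subtype.ext (Finset.eq_of_subset_of_card_le (fun b hb => ?_) ?_)).symm
    · obtain ⟨a, ha, rfl⟩ := Finset.mem_map.1 hb
      obtain ⟨W, haW, hWX, hW⟩ := Finset.exists_subsuperset_card_eq
        (Finset.singleton_subset_iff.2 ha) (n := k + 1) (by simp) (by rw [X.2]; omega)
      have h1 : (e ⟨W, hW⟩).val ⊆ (g X).val := hf ⟨W, hW⟩ X hWX
      rw [hσ] at h1
      exact h1 (Finset.mem_map_of_mem _ (Finset.singleton_subset_iff.1 haW))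
    · rw [(g X).2, (subsetPerm (k + 1 + 1) σ X).2]

end Johnson

section Fixity

theorem natCard_fixed_subsetPerm_le {α : Type*} [Finite α] {k : ℕ} (σ : Equiv.Perm α) (a : α) :
    Nat.card {X // subsetPerm k σ X = X}
      ≤ Nat.card {X : {S : Finset α // S.card = k} // a ∈ X.val ↔ σ a ∈ X.val} := by
  refine Nat.card_le_card_of_injective
    (Subtype.map id fun X (hX : subsetPerm k σ X = X) => ?_)
    (Subtype.map_injective _ Function.injective_id)
  nth_rw 2 [id, ← hX]
  simp [coe_subsetPerm]

variable {α : Type*} [Fintype α] [DecidableEq α]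

theorem card_filter_mem_notMem {k : ℕ} (hk : 0 < k) {a b : α} (hab : a ≠ b) :
    ((Finset.powersetCard k Finset.univ).filter fun S => a ∈ S ∧ b ∉ S).card
      = (Fintype.card α - 2).choose (k - 1) := by
  rw [← Finset.card_pair hab, ← Finset.card_compl, ← Finset.card_powersetCard]
  refine Finset.card_nbij' (fun S => S.erase a) (fun S => insert a S) ?_ ?_ ?_ ?_
  · intro S hS
    simp only [Finset.coe_filter, Finset.mem_powersetCard_univ, Set.mem_ofPred_eq] at hS
    refine Finset.mem_powersetCard.2 ⟨fun x hx => ?_, ?_⟩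
    · rw [Finset.mem_erase] at hx
      simp only [Finset.mem_compl, Finset.mem_insert, Finset.mem_singleton, not_or]
      exact ⟨hx.1, fun h => hS.2.2 (h ▸ hx.2)⟩
    · rw [Finset.card_erase_of_mem hS.2.1, hS.1]
  · intro S hS
    obtain ⟨hS, hSk⟩ := Finset.mem_powersetCard.1 (Finset.mem_coe.1 hS)
    have ha : a ∉ S := fun h => by simpa using hS h
    have hb : b ∉ S := fun h => by simpa using hS h
    simp only [Finset.coe_filter, Finset.mem_powersetCard_univ, Set.mem_ofPred_eq,
      Finset.card_insert_of_notMem ha, Finset.mem_insert, true_or, true_and, not_or]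
    exact ⟨by omega, hab.symm, hb⟩
  · intro S hS
    simp only [Finset.coe_filter, Set.mem_ofPred_eq] at hS
    exact Finset.insert_erase hS.2.1
  · intro S hS
    obtain ⟨hS, -⟩ := Finset.mem_powersetCard.1 (Finset.mem_coe.1 hS)
    exact Finset.erase_insert fun h => by simpa using hS h

theorem natCard_mem_iff_mem_add {k : ℕ} (hk : 0 < k) {a b : α} (hab : a ≠ b) :
    Nat.card {X : {S : Finset α // S.card = k} // a ∈ X.val ↔ b ∈ X.val}
      + 2 * (Fintype.card α - 2).choose (k - 1) = (Fintype.card α).choose k := by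
  rw [natCard_subtype_card_eq k fun S => a ∈ S ↔ b ∈ S, two_mul,
    ← Finset.card_univ (α := α), ← Finset.card_powersetCard k Finset.univ,
    ← Finset.card_filter_add_card_filter_not (s := Finset.powersetCard k (Finset.univ : Finset α))
      (fun S => a ∈ S ↔ b ∈ S), Finset.card_univ]
  congr 1
  nth_rw 1 [← card_filter_mem_notMem hk hab, ← card_filter_mem_notMem hk hab.symm]
  rw [← Finset.card_union_of_disjoint, ← Finset.filter_or]
  · congr 1
    refine Finset.filter_congr fun S _ => ?_
    tauto
  · refine Finset.disjoint_filter.2 fun S _ => ?_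
    tauto

theorem natCard_fixed_subsetPerm_swap {k : ℕ} (a b : α) :
    Nat.card {X // subsetPerm k (Equiv.swap a b) X = X}
      = Nat.card {X : {S : Finset α // S.card = k} // a ∈ X.val ↔ b ∈ X.val} := by
  refine le_antisymm ?_ ?_
  · simpa using natCard_fixed_subsetPerm_le (k := k) (Equiv.swap a b) a
  · refine Nat.card_le_card_of_injective (Subtype.map id fun X hX => Subtype.ext ?_)
      (Subtype.map_injective _ Function.injective_id)
    rw [id, coe_subsetPerm]
    ext x
    simp only [Finset.mem_map_equiv, Equiv.symm_swap]
    by_cases hxa : x = a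
    · rw [hxa, Equiv.swap_apply_left, hX]
    · by_cases hxb : x = b
      · rw [hxb, Equiv.swap_apply_right, hX]
      · rw [Equiv.swap_apply_of_ne_of_ne hxa hxb]

end Fixity

theorem choose_sub_two_mul {m k : ℕ} (hk : 0 < k) (hkm : k < m) :
    (m - 2).choose (k - 1) * (m * (m - 1)) = m.choose k * (k * (m - k)) := by
  obtain ⟨l, rfl⟩ : ∃ l, k = l + 1 := ⟨k - 1, by omega⟩
  obtain ⟨n, rfl⟩ : ∃ n, m = n + 2 := ⟨m - 2, by omega⟩
  have h1 := Nat.choose_mul_succ_eq n l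
  have h2 := Nat.add_one_mul_choose_eq (n + 1) l
  rw [show n + 2 - (l + 1) = n + 1 - l by omega, Nat.add_sub_cancel, Nat.add_sub_cancel,
    show n + 2 - 1 = n + 1 by omega]
  calc n.choose l * ((n + 2) * (n + 1)) = n.choose l * (n + 1) * (n + 2) := by ring
    _ = (n + 1 + 1) * (n + 1).choose l * (n + 1 - l) := by rw [h1]; ring
    _ = _ := by rw [h2]; ring

theorem digraphFixity_johnsonAdj_add {m k i : ℕ} (hi : 0 < i) (hik : i < k) (hm : 2 * k + 2 ≤ m) :
    digraphFixity (johnsonAdj m k i) + 2 * (m - 2).choose (k - 1) = m.choose k := by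
  have hcard {a b : Fin m} (hab : a ≠ b) := natCard_mem_iff_mem_add (k := k) (by omega) hab
  simp only [Fintype.card_fin] at hcard
  let a : Fin m := ⟨0, by omega⟩
  let b : Fin m := ⟨1, by omega⟩
  have hab : a ≠ b := by simp [a, b]
  rw [← hcard hab, digraphFixity]
  congr 1
  refine IsGreatest.csSup_eq ⟨⟨subsetPerm k (Equiv.swap a b),
    ⟨isDigraphAut_subsetPerm _, fun h => ?_⟩, natCard_fixed_subsetPerm_swap a b⟩, ?_⟩
  · have h1 := natCard_fixed_subsetPerm_swap (k := k) a b
    have h2 := hcard hab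
    have h3 : 0 < (m - 2).choose (k - 1) := Nat.choose_pos (by omega)
    rw [← h1, h] at h2
    have h4 : Nat.card {X : {S : Finset (Fin m) // S.card = k} //
        (1 : Equiv.Perm {S : Finset (Fin m) // S.card = k}) X = X} = m.choose k := by
      rw [Nat.card_congr (Equiv.subtypeUnivEquiv
        (p := fun X => (1 : Equiv.Perm {S : Finset (Fin m) // S.card = k}) X = X) fun X => rfl), Nat.card_eq_fintype_card,
        Fintype.card_finset_len, Fintype.card_fin]
    omega
  · rintro _ ⟨g, ⟨hg, hg1⟩, rfl⟩
    obtain ⟨l, rfl⟩ : ∃ l, k = l + 1 := ⟨k - 1, by omega⟩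
    obtain ⟨σ, rfl⟩ := exists_eq_subsetPerm (by rw [Fintype.card_fin]; omega) g
      (hg.johnsonAdj_one hi hik hm)
    obtain ⟨c, hc⟩ : ∃ c, σ c ≠ c := by
      by_contra! h
      obtain rfl : σ = 1 := Equiv.ext h
      refine hg1 (Equiv.ext fun X => Subtype.ext ?_)
      rw [coe_subsetPerm]
      exact Finset.map_refl
    refine (natCard_fixed_subsetPerm_le σ c).trans ?_
    have h1 := hcard hab
    have h2 := hcard hc.symm
    omega

/-- Let m, k, i be positive integers with m ≥ 2k+2 and i ≠ k (so
1 ≤ i ≤ k−1 and k ≥ 2). Then the relative fixity of the distance-i Johnson graph J(m,k,i)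
equals 1 − 2k(m−k)/(m(m−1)); equivalently, Fix(J(m,k,i)) = C(m,k) − 2·C(m−2,k−1). -/
theorem stmt_6 (m k i : ℕ) (hi : 0 < i) (hik : i ≤ k) (hik' : i ≠ k)
    (hm : 2 * k + 2 ≤ m) :
    digraphFixity (johnsonAdj m k i)
        = Nat.choose m k - 2 * Nat.choose (m - 2) (k - 1) ∧
    (digraphFixity (johnsonAdj m k i) : ℝ) / Nat.choose m k
        = 1 - (2 * k * ((m : ℝ) - k)) / (m * ((m : ℝ) - 1)) := by
  have h := digraphFixity_johnsonAdj_add hi (lt_of_le_of_ne hik hik') hm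
  refine ⟨by omega, ?_⟩
  have hpos : (0 : ℝ) < m.choose k := by
    exact_mod_cast Nat.choose_pos (show k ≤ m by omega)
  have hm1 : (1 : ℝ) < m := by exact_mod_cast show 1 < m by omega
  have hm0 : (m : ℝ) * (m - 1) ≠ 0 := by nlinarith
  have h1 : (digraphFixity (johnsonAdj m k i) : ℝ) + 2 * (m - 2).choose (k - 1) = m.choose k := by
    exact_mod_cast h
  have h2 : ((m - 2).choose (k - 1) : ℝ) * (m * (m - 1)) = m.choose k * (k * (m - k)) := by
    have := congrArg (Nat.cast (R := ℝ)) (choose_sub_two_mul (m := m) (k := k) (by omega) (by omega))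
    push_cast [Nat.cast_sub (show 1 ≤ m by omega), Nat.cast_sub (show k ≤ m by omega)] at this
    exact this
  rw [eq_sub_iff_add_eq, div_add_div _ _ hpos.ne' hm0, div_eq_one_iff_eq (by positivity)]
  linear_combination (m * (m - 1) : ℝ) * h1 - 2 * h2
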